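/- Let r be a positive integer and let Δ be a real number with 0 ≤ Δ < 1 and (r+Δ)² ≥ r² + 2r − 1. Then there exists an (r,Δ)-identifying code C ⊆ ℤ² with D(C) = 1/2, and every (r,Δ)-identifying code C' satisfies D(C') ≥ 1/2; that is, D(r,Δ) = 1/2. -/

import Mathlib

open Filter

def ball (r : ℝ) (u : ℤ × ℤ) : Set (ℤ × ℤ) :=
  {v : ℤ × ℤ | ((v.1 - u.1 : ℤ) : ℝ) ^ 2 + ((v.2 - u.2 : ℤ) : ℝ) ^ 2 ≤ r ^ 2}

def Spat (r Δ : ℝ) (u v : ℤ × ℤ) : Set (ℤ × ℤ) :=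
  (ball r u \ ball (r + Δ) v) ∪ (ball r v \ ball (r + Δ) u)

def IsIdCode (r Δ : ℝ) (C : Set (ℤ × ℤ)) : Prop :=
  (∀ u : ℤ × ℤ, (ball r u ∩ C).Nonempty) ∧
    ∀ u v : ℤ × ℤ, u ≠ v → (Spat r Δ u v ∩ C).Nonempty

def Qset (n : ℕ) : Set (ℤ × ℤ) := {p : ℤ × ℤ | |p.1| ≤ (n : ℤ) ∧ |p.2| ≤ (n : ℤ)}

noncomputable def density (C : Set (ℤ × ℤ)) : ℝ :=
  Filter.limsup
    (fun n : ℕ => (Nat.card ↥(C ∩ Qset n) : ℝ) / ((2 * (n : ℝ) + 1) ^ 2))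
    Filter.atTop

def IntersectsDiagMod (U : Set (ℤ × ℤ)) (k : ℕ) : Prop :=
  ∀ i : ℤ, ∃ p ∈ U, Int.ModEq (k : ℤ) (p.2 - p.1) i

def IntersectsAntiDiagMod (U : Set (ℤ × ℤ)) (k : ℕ) : Prop :=
  ∀ i : ℤ, ∃ p ∈ U, Int.ModEq (k : ℤ) (p.1 + p.2) i

def IntersectsHorizMod (U : Set (ℤ × ℤ)) (k : ℕ) : Prop :=
  ∀ i : ℤ, ∃ p ∈ U, Int.ModEq (k : ℤ) p.2 i

noncomputable def diagNum (U : Set (ℤ × ℤ)) : ℕ :=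
  sSup {k : ℕ | 0 < k ∧ IntersectsDiagMod U k}

def Lv (k : ℕ) : Set (ℤ × ℤ) := {p : ℤ × ℤ | (k : ℤ) ∣ p.1}
def Lh (k : ℕ) : Set (ℤ × ℤ) := {p : ℤ × ℤ | (k : ℤ) ∣ p.2}
def Ld (k : ℕ) : Set (ℤ × ℤ) := {p : ℤ × ℤ | (k : ℤ) ∣ (p.2 - p.1)}

/-- The predicate on columns used by `stripeCode`; it changes value three times in every
`2 * R + 1` consecutive integers. -/
def ColPred (R x : ℤ) : Prop :=
  x % (4 * R + 2) = 0 ∨ (R + 1 ≤ x % (4 * R + 2) ∧ x % (4 * R + 2) ≤ 2 * R) ∨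
    (2 * R + 2 ≤ x % (4 * R + 2) ∧ x % (4 * R + 2) ≤ 3 * R + 1)

/-- The predicate on rows used by `stripeCode`: blocks of `2 * R + 1` consecutive integers. -/
def RowPred (R y : ℤ) : Prop := y % (4 * R + 2) < 2 * R + 1

/-- A code of density `1 / 2` meeting every set `Spat r Δ u v` with `Δ < 1`. -/
def stripeCode (R : ℤ) : Set (ℤ × ℤ) := {p | ColPred R p.1 ↔ RowPred R p.2}

lemma add_emod_cases {M k : ℤ} (x : ℤ) (hk : 0 ≤ k) (hkM : k < M) :
    ((x % M + k < M ∧ (x + k) % M = x % M + k) ∨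
      (M ≤ x % M + k ∧ (x + k) % M = x % M + k - M)) := by
  have h0 := Int.emod_nonneg x (show M ≠ 0 by omega)
  have h1 := Int.emod_lt_of_pos x (show 0 < M by omega)
  rw [← Int.emod_add_emod]
  generalize x % M = z at *
  rcases lt_or_ge (z + k) M with h | h
  · exact Or.inl ⟨h, Int.emod_eq_of_lt (by omega) h⟩
  · refine Or.inr ⟨h, ?_⟩
    rw [← Int.sub_emod_right]
    exact Int.emod_eq_of_lt (by omega) (by omega)

lemma emod_period_bounds {R : ℤ} (hR : 1 ≤ R) (x : ℤ) :
    0 ≤ x % (4 * R + 2) ∧ x % (4 * R + 2) < 4 * R + 2 :=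
  ⟨Int.emod_nonneg x (by omega), Int.emod_lt_of_pos x (by omega)⟩

lemma colPred_add {R : ℤ} (hR : 1 ≤ R) (x : ℤ) :
    ColPred R (x + (2 * R + 1)) ↔ ¬ ColPred R x := by
  have h0 := emod_period_bounds hR x
  have h1 := add_emod_cases (M := 4 * R + 2) (k := 2 * R + 1) x (by omega) (by omega)
  unfold ColPred
  generalize x % (4 * R + 2) = z at *
  generalize (x + (2 * R + 1)) % (4 * R + 2) = w at *
  omega

lemma rowPred_add {R : ℤ} (hR : 1 ≤ R) (y : ℤ) :
    RowPred R (y + (2 * R + 1)) ↔ ¬ RowPred R y := by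
  have h0 := emod_period_bounds hR y
  have h1 := add_emod_cases (M := 4 * R + 2) (k := 2 * R + 1) y (by omega) (by omega)
  unfold RowPred
  generalize y % (4 * R + 2) = z at *
  generalize (y + (2 * R + 1)) % (4 * R + 2) = w at *
  omega

lemma colPred_jump {R : ℤ} (hR : 1 ≤ R) (x : ℤ) :
    (ColPred R (x + R) ↔ ColPred R (x + (R + 1))) ∨ (ColPred R x ↔ ¬ ColPred R (x + R)) := by
  have h0 := emod_period_bounds hR x
  have h1 := add_emod_cases (M := 4 * R + 2) (k := R) x (by omega) (by omega)
  have h2 := add_emod_cases (M := 4 * R + 2) (k := R + 1) x (by omega) (by omega)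
  unfold ColPred
  generalize x % (4 * R + 2) = z at *
  generalize (x + R) % (4 * R + 2) = w at *
  generalize (x + (R + 1)) % (4 * R + 2) = w' at *
  omega

lemma rowPred_jump {R : ℤ} (hR : 1 ≤ R) (y : ℤ) :
    (RowPred R (y + R) ↔ RowPred R (y + (R + 1))) ∨
      ((RowPred R y ↔ RowPred R (y + R)) ∧ (RowPred R (y + (R + 1)) ↔ ¬ RowPred R y)) := by
  have h0 := emod_period_bounds hR y
  have h1 := add_emod_cases (M := 4 * R + 2) (k := R) y (by omega) (by omega)
  have h2 := add_emod_cases (M := 4 * R + 2) (k := R + 1) y (by omega) (by omega)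
  unfold RowPred
  generalize y % (4 * R + 2) = z at *
  generalize (y + R) % (4 * R + 2) = w at *
  generalize (y + (R + 1)) % (4 * R + 2) = w' at *
  omega

lemma exists_colPred_iff {R : ℤ} (hR : 1 ≤ R) (x : ℤ) (P : Prop) :
    ∃ k, 0 ≤ k ∧ k ≤ 2 * R ∧ (ColPred R (x + k) ↔ P) := by
  have key : (ColPred R (x + R) ↔ ¬ ColPred R x) ∨ (ColPred R (x + 2 * R) ↔ ¬ ColPred R x) := by
    have h0 := emod_period_bounds hR x
    have h1 := add_emod_cases (M := 4 * R + 2) (k := R) x (by omega) (by omega)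
    have h2 := add_emod_cases (M := 4 * R + 2) (k := 2 * R) x (by omega) (by omega)
    unfold ColPred
    generalize x % (4 * R + 2) = z at *
    generalize (x + R) % (4 * R + 2) = w at *
    generalize (x + 2 * R) % (4 * R + 2) = w' at *
    omega
  by_cases hx : ColPred R x ↔ P
  · exact ⟨0, le_rfl, by omega, by simpa using hx⟩
  · rcases key with h | h
    · exact ⟨R, by omega, by omega, by grind⟩
    · exact ⟨2 * R, by omega, by omega, by grind⟩

lemma exists_colPred_iff_of_le_two {R : ℤ} (hR : 1 ≤ R) (hR2 : R ≤ 2) (x : ℤ) (P : Prop) :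
    ∃ k, 0 ≤ k ∧ k ≤ 2 ∧ (ColPred R (x + k) ↔ P) := by
  have key : (ColPred R (x + 1) ↔ ¬ ColPred R x) ∨ (ColPred R (x + 2) ↔ ¬ ColPred R x) := by
    have h0 := emod_period_bounds hR x
    have h1 := add_emod_cases (M := 4 * R + 2) (k := 1) x (by omega) (by omega)
    have h2 := add_emod_cases (M := 4 * R + 2) (k := 2) x (by omega) (by omega)
    unfold ColPred
    generalize x % (4 * R + 2) = z at *
    generalize (x + 1) % (4 * R + 2) = w at *
    generalize (x + 2) % (4 * R + 2) = w' at *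
    omega
  by_cases hx : ColPred R x ↔ P
  · exact ⟨0, le_rfl, by omega, by simpa using hx⟩
  · rcases key with h | h
    · exact ⟨1, by omega, by omega, by grind⟩
    · exact ⟨2, by omega, by omega, by grind⟩

lemma mem_stripeCode_add_fst {R : ℤ} (hR : 1 ≤ R) (x y : ℤ) :
    (x + (2 * R + 1), y) ∈ stripeCode R ↔ (x, y) ∉ stripeCode R := by
  have := colPred_add hR x
  simp only [stripeCode, Set.mem_ofPred_eq]
  grind

lemma mem_stripeCode_add_snd {R : ℤ} (hR : 1 ≤ R) (x y : ℤ) :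
    (x, y + (2 * R + 1)) ∈ stripeCode R ↔ (x, y) ∉ stripeCode R := by
  have := rowPred_add hR y
  simp only [stripeCode, Set.mem_ofPred_eq]
  grind

lemma stripeCode_diag {R : ℤ} (hR : 1 ≤ R) (x y : ℤ) :
    (x, y + R) ∈ stripeCode R ∨ (x + R, y) ∈ stripeCode R ∨
      (x + (2 * R + 1), y + (R + 1)) ∈ stripeCode R ∨
      (x + (R + 1), y + (2 * R + 1)) ∈ stripeCode R := by
  rw [mem_stripeCode_add_fst hR, mem_stripeCode_add_snd hR]
  have h1 := colPred_jump hR x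
  have h2 := rowPred_jump hR y
  simp only [stripeCode, Set.mem_ofPred_eq]
  grind

lemma stripeCode_antidiag {R : ℤ} (hR : 1 ≤ R) (x y : ℤ) :
    (x, y + (R + 1)) ∈ stripeCode R ∨ (x + R, y + (2 * R + 1)) ∈ stripeCode R ∨
      (x + (2 * R + 1), y + R) ∈ stripeCode R ∨ (x + (R + 1), y) ∈ stripeCode R := by
  rw [mem_stripeCode_add_fst hR, mem_stripeCode_add_snd hR]
  have h1 := colPred_jump hR x
  have h2 := rowPred_jump hR y
  simp only [stripeCode, Set.mem_ofPred_eq]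
  grind

/-- The two balls of radius `R` around the origin and `(c, d)` meet. -/
def BallsMeet (R c d : ℤ) : Prop :=
  ∃ x y : ℤ, x ^ 2 + y ^ 2 ≤ R ^ 2 ∧ (x - c) ^ 2 + (y - d) ^ 2 ≤ R ^ 2

lemma BallsMeet.neg_fst {R c d : ℤ} (h : BallsMeet R c d) : BallsMeet R (-c) d := by
  obtain ⟨x, y, h1, h2⟩ := h
  exact ⟨-x, y, by linarith [neg_sq x], by nlinarith⟩

lemma BallsMeet.neg_snd {R c d : ℤ} (h : BallsMeet R c d) : BallsMeet R c (-d) := by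
  obtain ⟨x, y, h1, h2⟩ := h
  exact ⟨x, -y, by linarith [neg_sq y], by nlinarith⟩

lemma BallsMeet.swap {R c d : ℤ} (h : BallsMeet R c d) : BallsMeet R d c := by
  obtain ⟨x, y, h1, h2⟩ := h
  exact ⟨y, x, by linarith, by linarith⟩

lemma ballsMeet_of_large {R a b : ℤ} (hR : 3 ≤ R) (hb : 1 ≤ b) (hba : b ≤ a) (ha : 2 ≤ a)
    (hab : a ^ 2 + b ^ 2 < (2 * R + 1) ^ 2) : BallsMeet R (2 * R + 1 - a) b := by
  rcases Int.even_or_odd' b with ⟨t, rfl | rfl⟩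
  · rcases eq_or_lt_of_le ha with rfl | ha'
    · obtain rfl : t = 1 := by omega
      refine ⟨R, 0, by nlinarith, ?_⟩
      ring_nf
      nlinarith
    · have key : (2 * R + 2 - a) ^ 2 + (2 * t) ^ 2 ≤ (2 * R) ^ 2 := by
        rcases le_or_gt (R + 2) a with h | h
        · nlinarith
        · have h1 : (2 * t) ^ 2 ≤ a ^ 2 := by gcongr
          nlinarith [mul_nonneg (show 0 ≤ a - 3 by omega) (show 0 ≤ R + 1 - a by omega)]
      rcases Int.even_or_odd' a with ⟨s, rfl | rfl⟩
      · refine ⟨R - s, t, ?_, ?_⟩ <;> nlinarith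
      · refine ⟨R - s, t, ?_, ?_⟩ <;> nlinarith
  · have hbsq : (2 * t + 1) ^ 2 ≤ a ^ 2 := by gcongr
    rcases Int.even_or_odd' a with ⟨s, rfl | rfl⟩
    · have hts : t + 1 ≤ s := by omega
      have hs : s ≤ R := by nlinarith
      refine ⟨R - s, t + 1, ?_, ?_⟩
      · have key : s ^ 2 + (t + 1) ^ 2 ≤ 2 * s * R := by
          have h1 : (t + 1) ^ 2 ≤ s ^ 2 := by gcongr; omega
          nlinarith
        nlinarith
      · have key : (R + 1 - s) ^ 2 + t ^ 2 ≤ R ^ 2 := by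
          have h1 : t ^ 2 ≤ (s - 1) ^ 2 := by gcongr <;> omega
          nlinarith [mul_nonneg (show 0 ≤ s - 1 by omega) (show 0 ≤ R - s by omega)]
        nlinarith
    · have hs1 : 1 ≤ s := by omega
      have key : (R - s) ^ 2 + (t + 1) ^ 2 ≤ R ^ 2 := by
        rcases le_or_gt s (R - 2) with h | h
        · have h1 : (t + 1) ^ 2 ≤ (s + 1) ^ 2 := by gcongr <;> omega
          nlinarith [mul_nonneg (show 0 ≤ s by omega) (show 0 ≤ R - 2 - s by omega)]
        · have hs : s < R := by nlinarith
          obtain rfl : s = R - 1 := by omega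
          have h1 : t ≤ R - 2 := by nlinarith
          have h2 : (t + 1) ^ 2 ≤ (R - 1) ^ 2 := by gcongr <;> omega
          nlinarith
      refine ⟨R - s, t, ?_, ?_⟩ <;> nlinarith

lemma ballsMeet_or {R a b : ℤ} (hR : 1 ≤ R) (hb : 0 ≤ b) (hba : b ≤ a) (ha : 1 ≤ a)
    (hab : a ^ 2 + b ^ 2 < (2 * R + 1) ^ 2) :
    (a = 1 ∧ b = 1) ∨ (R ≤ 2 ∧ 2 ≤ b) ∨ BallsMeet R (2 * R + 1 - a) b := by
  rcases eq_or_lt_of_le hb with rfl | hb'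
  · have h1 : a < 2 * R + 1 := by nlinarith
    refine Or.inr (Or.inr ⟨R + 1 - a, 0, ?_, ?_⟩) <;> nlinarith
  rcases eq_or_lt_of_le ha with rfl | ha'
  · exact Or.inl ⟨rfl, by omega⟩
  rcases le_or_gt 3 R with h3 | h3
  · exact Or.inr (Or.inr (ballsMeet_of_large h3 hb' hba ha' hab))
  rcases le_or_gt 2 b with h2 | h2
  · exact Or.inr (Or.inl ⟨by omega, h2⟩)
  obtain rfl : b = 1 := by omega
  have h4 : a ≤ 2 * R := by nlinarith
  refine Or.inr (Or.inr ?_)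
  rcases Int.even_or_odd' a with ⟨s, rfl | rfl⟩
  · exact ⟨R - s, 1, by nlinarith, by nlinarith⟩
  · exact ⟨R - s, 0, by nlinarith, by nlinarith⟩

lemma separation_cases {R : ℤ} (hR : 1 ≤ R) (a b : ℤ) (h0 : a ≠ 0 ∨ b ≠ 0) :
    (|a| = 1 ∧ |b| = 1) ∨ (2 * R + 1) ^ 2 ≤ a ^ 2 + b ^ 2 ∨ (R ≤ 2 ∧ 2 ≤ |b|) ∨
      BallsMeet R (a - (2 * R + 1)) b ∨ BallsMeet R (a + (2 * R + 1)) b ∨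
      BallsMeet R a (b - (2 * R + 1)) ∨ BallsMeet R a (b + (2 * R + 1)) := by
  rcases le_or_gt ((2 * R + 1) ^ 2) (a ^ 2 + b ^ 2) with hfar | hnear
  · exact Or.inr (Or.inl hfar)
  have hnear' : |a| ^ 2 + |b| ^ 2 < (2 * R + 1) ^ 2 := by rwa [sq_abs, sq_abs]
  rcases le_total |b| |a| with hle | hle
  · have ha : 1 ≤ |a| := by
      rcases h0 with h | h
      · exact Int.one_le_abs h
      · exact (Int.one_le_abs h).trans hle
    rcases ballsMeet_or hR (abs_nonneg b) hle ha hnear' with h | h | h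
    · exact Or.inl h
    · exact Or.inr (Or.inr (Or.inl h))
    · refine Or.inr (Or.inr (Or.inr ?_))
      have h1 : BallsMeet R (2 * R + 1 - |a|) b := by
        rcases abs_choice b with hb | hb
        · rwa [hb] at h
        · rw [hb] at h
          simpa using h.neg_snd
      rcases abs_choice a with ha | ha
      · left
        rw [ha] at h1
        simpa using h1.neg_fst
      · right; left
        rw [ha] at h1
        rwa [show a + (2 * R + 1) = 2 * R + 1 - -a by ring]
  · have hb : 1 ≤ |b| := by
      rcases h0 with h | h
      · exact (Int.one_le_abs h).trans hle
      · exact Int.one_le_abs h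
    rcases ballsMeet_or hR (abs_nonneg a) hle hb (by linarith) with h | h | h
    · exact Or.inl h.symm
    · exact Or.inr (Or.inr (Or.inl ⟨h.1, h.2.trans hle⟩))
    · refine Or.inr (Or.inr (Or.inr (Or.inr (Or.inr ?_))))
      have h1 : BallsMeet R a (2 * R + 1 - |b|) := by
        rcases abs_choice a with ha | ha
        · rw [ha] at h
          exact h.swap
        · rw [ha] at h
          simpa using h.neg_snd.swap
      rcases abs_choice b with hb | hb
      · left
        rw [hb] at h1
        simpa using h1.neg_snd
      · right
        rw [hb] at h1
        rwa [show b + (2 * R + 1) = 2 * R + 1 - -b by ring]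

lemma mem_ball_of_sq_le {r : ℕ} {u p : ℤ × ℤ}
    (h : (p.1 - u.1) ^ 2 + (p.2 - u.2) ^ 2 ≤ (r : ℤ) ^ 2) : p ∈ ball r u := by
  simp only [ball, Set.mem_ofPred_eq]
  exact_mod_cast h

lemma notMem_ball_of_le_sq {r : ℕ} {Δ : ℝ} (hΔ0 : 0 ≤ Δ) (hΔ1 : Δ < 1) {u p : ℤ × ℤ}
    (h : ((r : ℤ) + 1) ^ 2 ≤ (p.1 - u.1) ^ 2 + (p.2 - u.2) ^ 2) : p ∉ ball (r + Δ) u := by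
  simp only [ball, Set.mem_ofPred_eq, not_le]
  have h1 : ((r : ℝ) + 1) ^ 2 ≤ ((p.1 - u.1 : ℤ) : ℝ) ^ 2 + ((p.2 - u.2 : ℤ) : ℝ) ^ 2 := by
    exact_mod_cast h
  have h2 : (0 : ℝ) ≤ r := Nat.cast_nonneg r
  nlinarith

lemma mem_Spat_of_sq {r : ℕ} {Δ : ℝ} (hΔ0 : 0 ≤ Δ) (hΔ1 : Δ < 1) {u v p : ℤ × ℤ}
    (h1 : (p.1 - u.1) ^ 2 + (p.2 - u.2) ^ 2 ≤ (r : ℤ) ^ 2)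
    (h2 : ((r : ℤ) + 1) ^ 2 ≤ (p.1 - v.1) ^ 2 + (p.2 - v.2) ^ 2) : p ∈ Spat r Δ u v :=
  Or.inl ⟨mem_ball_of_sq_le h1, notMem_ball_of_le_sq hΔ0 hΔ1 h2⟩

lemma Spat_comm (r Δ : ℝ) (u v : ℤ × ℤ) : Spat r Δ u v = Spat r Δ v u := Set.union_comm _ _

lemma sq_le_of_far {R x y a b : ℤ} (hR : 1 ≤ R) (h1 : x ^ 2 + y ^ 2 ≤ R ^ 2)
    (h2 : (2 * R + 1) ^ 2 ≤ a ^ 2 + b ^ 2) : (R + 1) ^ 2 ≤ (x - a) ^ 2 + (y - b) ^ 2 := by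
  by_contra! h
  set s := a - x with hs
  set t := b - y with ht
  have ha : a = x + s := by omega
  have hb : b = y + t := by omega
  have h3 : s ^ 2 + t ^ 2 < (R + 1) ^ 2 := by nlinarith
  have h4 : (x * s + y * t) ^ 2 ≤ (R * (R + 1)) ^ 2 := by
    calc (x * s + y * t) ^ 2 ≤ (x ^ 2 + y ^ 2) * (s ^ 2 + t ^ 2) := by
          nlinarith [sq_nonneg (x * t - y * s)]
      _ ≤ R ^ 2 * (R + 1) ^ 2 := by gcongr
      _ = (R * (R + 1)) ^ 2 := by ring
  have h5 : x * s + y * t ≤ R * (R + 1) := (abs_le_of_sq_le_sq' h4 (by positivity)).2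
  rw [ha, hb] at h2
  nlinarith

lemma exists_mem_stripeCode_of_near {R : ℤ} (hR : 1 ≤ R) (u : ℤ × ℤ) :
    ∃ p ∈ stripeCode R, (p.1 - u.1) ^ 2 + (p.2 - u.2) ^ 2 ≤ R ^ 2 := by
  obtain ⟨k, hk0, hk1, hk⟩ := exists_colPred_iff hR (u.1 - R) (RowPred R u.2)
  refine ⟨(u.1 - R + k, u.2), hk, ?_⟩
  simp only
  nlinarith

lemma Spat_inter_stripeCode_of_fst {r : ℕ} (hr : 0 < r) {Δ : ℝ} (hΔ0 : 0 ≤ Δ) (hΔ1 : Δ < 1)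
    {u v : ℤ × ℤ} (h : BallsMeet r (v.1 - u.1 - (2 * r + 1)) (v.2 - u.2)) :
    (Spat r Δ u v ∩ stripeCode r).Nonempty := by
  obtain ⟨x, y, h1, h2⟩ := h
  have hx : -(r : ℤ) ≤ x := (abs_le_of_sq_le_sq' (by nlinarith) (by positivity)).1
  have hx' : x - (v.1 - u.1 - (2 * r + 1)) ≤ r :=
    (abs_le_of_sq_le_sq' (by nlinarith [sq_nonneg (y - (v.2 - u.2))]) (by positivity)).2
  by_cases hp : (u.1 + x, u.2 + y) ∈ stripeCode r
  · refine ⟨_, mem_Spat_of_sq hΔ0 hΔ1 ?_ ?_, hp⟩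
    · simpa using h1
    · simp only
      nlinarith [sq_nonneg (u.2 + y - v.2)]
  · rw [← mem_stripeCode_add_fst (by omega)] at hp
    refine ⟨_, ?_, hp⟩
    rw [Spat_comm]
    refine mem_Spat_of_sq hΔ0 hΔ1 ?_ ?_
    · simp only
      nlinarith
    · simp only
      nlinarith [sq_nonneg y]

lemma Spat_inter_stripeCode_of_snd {r : ℕ} (hr : 0 < r) {Δ : ℝ} (hΔ0 : 0 ≤ Δ) (hΔ1 : Δ < 1)
    {u v : ℤ × ℤ} (h : BallsMeet r (v.1 - u.1) (v.2 - u.2 - (2 * r + 1))) :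
    (Spat r Δ u v ∩ stripeCode r).Nonempty := by
  obtain ⟨x, y, h1, h2⟩ := h
  have hy : -(r : ℤ) ≤ y := (abs_le_of_sq_le_sq' (by nlinarith) (by positivity)).1
  have hy' : y - (v.2 - u.2 - (2 * r + 1)) ≤ r :=
    (abs_le_of_sq_le_sq' (by nlinarith [sq_nonneg (x - (v.1 - u.1))]) (by positivity)).2
  by_cases hp : (u.1 + x, u.2 + y) ∈ stripeCode r
  · refine ⟨_, mem_Spat_of_sq hΔ0 hΔ1 ?_ ?_, hp⟩
    · simpa using h1
    · simp only
      nlinarith [sq_nonneg (u.1 + x - v.1)]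
  · rw [← mem_stripeCode_add_snd (by omega)] at hp
    refine ⟨_, ?_, hp⟩
    rw [Spat_comm]
    refine mem_Spat_of_sq hΔ0 hΔ1 ?_ ?_
    · simp only
      nlinarith
    · simp only
      nlinarith [sq_nonneg x]

lemma Spat_inter_stripeCode_of_diag {r : ℕ} (hr : 0 < r) {Δ : ℝ} (hΔ0 : 0 ≤ Δ) (hΔ1 : Δ < 1)
    {u v : ℤ × ℤ} (h1 : v.1 - u.1 = 1) (h2 : |v.2 - u.2| = 1) :
    (Spat r Δ u v ∩ stripeCode r).Nonempty := by
  have hv1 : v.1 = u.1 + 1 := by omega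
  have hr' : (1 : ℤ) ≤ r := by omega
  rcases (abs_eq zero_le_one).1 h2 with h2 | h2
  · have hv2 : v.2 = u.2 + 1 := by omega
    rcases stripeCode_diag hr' (u.1 - r) (u.2 - r) with h | h | h | h
    all_goals refine ⟨_, ?_, h⟩
    on_goal 3 => rw [Spat_comm]
    on_goal 4 => rw [Spat_comm]
    all_goals refine mem_Spat_of_sq hΔ0 hΔ1 ?_ ?_
    all_goals
      try rw [hv1, hv2]
      nlinarith
  · have hv2 : v.2 = u.2 - 1 := by omega
    rcases stripeCode_antidiag hr' (u.1 - r) (u.2 - r - 1) with h | h | h | h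
    all_goals refine ⟨_, ?_, h⟩
    on_goal 3 => rw [Spat_comm]
    on_goal 4 => rw [Spat_comm]
    all_goals refine mem_Spat_of_sq hΔ0 hΔ1 ?_ ?_
    all_goals
      try rw [hv1, hv2]
      nlinarith

lemma Spat_inter_stripeCode_of_le_two {r : ℕ} (hr : 0 < r) (hr2 : (r : ℤ) ≤ 2) {Δ : ℝ}
    (hΔ0 : 0 ≤ Δ) (hΔ1 : Δ < 1) {u v : ℤ × ℤ} (h2 : 2 ≤ |v.2 - u.2|) :
    (Spat r Δ u v ∩ stripeCode r).Nonempty := by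
  obtain ⟨t, ht, htv⟩ : ∃ t : ℤ, t ^ 2 = (r - 1) ^ 2 ∧ (r + 1 : ℤ) ^ 2 ≤ (u.2 + t - v.2) ^ 2 := by
    rcases le_abs.1 h2 with h | h
    · exact ⟨-(r - 1), by ring, by nlinarith⟩
    · exact ⟨r - 1, by ring, by nlinarith⟩
  obtain ⟨k, hk0, hk1, hk⟩ :=
    exists_colPred_iff_of_le_two (by omega) hr2 (u.1 - 1) (RowPred r (u.2 + t))
  refine ⟨(u.1 - 1 + k, u.2 + t), mem_Spat_of_sq hΔ0 hΔ1 ?_ ?_, hk⟩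
  · simp only
    nlinarith
  · simp only
    nlinarith [sq_nonneg (u.1 - 1 + k - v.1)]

lemma isIdCode_stripeCode {r : ℕ} (hr : 0 < r) {Δ : ℝ} (hΔ0 : 0 ≤ Δ) (hΔ1 : Δ < 1) :
    IsIdCode r Δ (stripeCode r) := by
  have hr' : (1 : ℤ) ≤ r := by omega
  refine ⟨fun u => ?_, fun u v huv => ?_⟩
  · obtain ⟨p, hp, hpu⟩ := exists_mem_stripeCode_of_near hr' u
    exact ⟨p, mem_ball_of_sq_le hpu, hp⟩
  have hne : v.1 - u.1 ≠ 0 ∨ v.2 - u.2 ≠ 0 := by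
    by_contra! h
    exact huv (Prod.ext (by omega) (by omega))
  rcases separation_cases hr' _ _ hne with h | h | h | h | h | h | h
  · rcases (abs_eq zero_le_one).1 h.1 with h1 | h1
    · exact Spat_inter_stripeCode_of_diag hr hΔ0 hΔ1 h1 h.2
    · rw [Spat_comm]
      exact Spat_inter_stripeCode_of_diag hr hΔ0 hΔ1 (by omega) (by rw [abs_sub_comm]; exact h.2)
  · obtain ⟨p, hp, hpu⟩ := exists_mem_stripeCode_of_near hr' u
    refine ⟨p, mem_Spat_of_sq hΔ0 hΔ1 hpu ?_, hp⟩
    simpa using sq_le_of_far hr' hpu h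
  · exact Spat_inter_stripeCode_of_le_two hr h.1 hΔ0 hΔ1 h.2
  · exact Spat_inter_stripeCode_of_fst hr hΔ0 hΔ1 h
  · rw [Spat_comm]
    refine Spat_inter_stripeCode_of_fst hr hΔ0 hΔ1 ?_
    convert h.neg_fst.neg_snd using 1 <;> ring
  · exact Spat_inter_stripeCode_of_snd hr hΔ0 hΔ1 h
  · rw [Spat_comm]
    refine Spat_inter_stripeCode_of_snd hr hΔ0 hΔ1 ?_
    convert h.neg_fst.neg_snd using 1 <;> ring

lemma Qset_eq (n : ℕ) : Qset n = ↑(Finset.Icc (-(n : ℤ)) n ×ˢ Finset.Icc (-(n : ℤ)) n) := by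
  ext p
  simp only [Qset, abs_le, Set.mem_ofPred_eq, Finset.coe_product, Finset.coe_Icc, Set.mem_prod,
    Set.mem_Icc]

lemma finite_inter_Qset (C : Set (ℤ × ℤ)) (n : ℕ) : (C ∩ Qset n).Finite := by
  rw [Qset_eq]
  exact (Finset.finite_toSet _).inter_of_right C

lemma ncard_Qset (n : ℕ) : (Qset n).ncard = (2 * n + 1) ^ 2 := by
  rw [Qset_eq, Set.ncard_coe_finset, Finset.card_product, Int.card_Icc,
    show ((n : ℤ) + 1 - -n).toNat = 2 * n + 1 by omega, sq]

lemma ncard_inter_add_ncard_compl_inter (C : Set (ℤ × ℤ)) (n : ℕ) :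
    (C ∩ Qset n).ncard + (Cᶜ ∩ Qset n).ncard = (2 * n + 1) ^ 2 := by
  rw [← ncard_Qset, ← Set.ncard_union_eq
    (disjoint_compl_right.mono Set.inter_subset_left Set.inter_subset_left)
    (finite_inter_Qset _ _) (finite_inter_Qset _ _), ← Set.union_inter_distrib_right,
    Set.union_compl_self, Set.univ_inter]

lemma sq_le_two_mul_ncard_inter {C : Set (ℤ × ℤ)} {m : ℕ}
    (hC : ∀ x y : ℤ, (x, y) ∈ C ∨ (x + m, y) ∈ C) (n : ℕ) :
    (2 * n + 1) ^ 2 ≤ 2 * (C ∩ Qset (n + m)).ncard := by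
  have h1 : (C ∩ Qset n).ncard ≤ (C ∩ Qset (n + m)).ncard := by
    refine Set.ncard_le_ncard (fun p hp => ⟨hp.1, ?_⟩) (finite_inter_Qset _ _)
    obtain ⟨h1, h2⟩ := hp.2
    constructor <;> push_cast <;> omega
  have h2 : (Cᶜ ∩ Qset n).ncard ≤ (C ∩ Qset (n + m)).ncard := by
    refine Set.ncard_le_ncard_of_injOn (fun p => (p.1 + m, p.2)) (fun p hp => ?_) ?_
      (finite_inter_Qset _ _)
    · refine ⟨(hC p.1 p.2).resolve_left hp.1, ?_⟩
      obtain ⟨h1, h2⟩ := hp.2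
      rw [abs_le] at h1 h2
      constructor <;> rw [abs_le] <;> push_cast <;> constructor <;> omega
    · intro p _ q _ h
      simp only [Prod.mk.injEq] at h
      exact Prod.ext (by omega) h.2
  have h3 := ncard_inter_add_ncard_compl_inter C n
  omega

/-- The proportion of `Qset n` covered by `C`. -/
noncomputable def proportion (C : Set (ℤ × ℤ)) (n : ℕ) : ℝ :=
  ((C ∩ Qset n).ncard : ℝ) / (2 * (n : ℝ) + 1) ^ 2

lemma density_eq_limsup_proportion (C : Set (ℤ × ℤ)) :
    density C = limsup (proportion C) atTop := by
  simp only [density, Nat.card_coe_set_eq]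
  rfl

lemma proportion_add_proportion_compl (C : Set (ℤ × ℤ)) (n : ℕ) :
    proportion C n + proportion Cᶜ n = 1 := by
  have h : ((C ∩ Qset n).ncard : ℝ) + (Cᶜ ∩ Qset n).ncard = (2 * (n : ℝ) + 1) ^ 2 := by
    exact_mod_cast ncard_inter_add_ncard_compl_inter C n
  rw [proportion, proportion, ← add_div, h, div_self (by positivity)]

lemma proportion_nonneg (C : Set (ℤ × ℤ)) (n : ℕ) : 0 ≤ proportion C n := by
  unfold proportion
  positivity

lemma proportion_le_one (C : Set (ℤ × ℤ)) (n : ℕ) : proportion C n ≤ 1 := by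
  linarith [proportion_add_proportion_compl C n, proportion_nonneg Cᶜ n]

/-- The lower bound for the proportion coming from `sq_le_two_mul_ncard_inter`. -/
noncomputable def proportionBound (m n : ℕ) : ℝ := (1 - 2 * m / (2 * (n : ℝ) + 1)) ^ 2 / 2

lemma tendsto_proportionBound (m : ℕ) :
    Tendsto (proportionBound m) atTop (nhds (1 / 2)) := by
  have h1 : Tendsto (fun n : ℕ => 2 * (n : ℝ) + 1) atTop atTop :=
    tendsto_atTop_add_const_right _ _
      (tendsto_natCast_atTop_atTop.const_mul_atTop (by norm_num))
  have h2 := ((h1.const_div_atTop (2 * (m : ℝ))).const_sub 1).pow 2 |>.div_const 2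
  have e : proportionBound m = fun n : ℕ => (1 - 2 * m / (2 * (n : ℝ) + 1)) ^ 2 / 2 := rfl
  simpa [e] using h2

lemma proportionBound_le {C : Set (ℤ × ℤ)} {m : ℕ}
    (hC : ∀ x y : ℤ, (x, y) ∈ C ∨ (x + m, y) ∈ C) :
    ∀ᶠ n in atTop, proportionBound m n ≤ proportion C n := by
  filter_upwards [eventually_ge_atTop m] with n hn
  obtain ⟨k, rfl⟩ := Nat.exists_eq_add_of_le' hn
  have h : (2 * (k : ℝ) + 1) ^ 2 ≤ 2 * ((C ∩ Qset (k + m)).ncard : ℝ) := by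
    exact_mod_cast sq_le_two_mul_ncard_inter hC k
  have hpos : (0 : ℝ) < 2 * ((k + m : ℕ) : ℝ) + 1 := by positivity
  have e : proportionBound m (k + m) =
      ((2 * (k : ℝ) + 1) ^ 2 / 2) / (2 * ((k + m : ℕ) : ℝ) + 1) ^ 2 := by
    unfold proportionBound
    field_simp
    push_cast
    ring
  rw [e, proportion]
  gcongr
  linarith

lemma half_le_density {C : Set (ℤ × ℤ)} {m : ℕ}
    (hC : ∀ x y : ℤ, (x, y) ∈ C ∨ (x + m, y) ∈ C) : 1 / 2 ≤ density C := by
  rw [density_eq_limsup_proportion, ← (tendsto_proportionBound m).limsup_eq]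
  exact limsup_le_limsup (proportionBound_le hC)
    (tendsto_proportionBound m).isBoundedUnder_ge.isCoboundedUnder_le
    (isBoundedUnder_of ⟨1, proportion_le_one C⟩)

lemma density_eq_half {C : Set (ℤ × ℤ)} {m : ℕ}
    (hC : ∀ x y : ℤ, (x + m, y) ∈ C ↔ (x, y) ∉ C) : density C = 1 / 2 := by
  rw [density_eq_limsup_proportion]
  have h1 := tendsto_proportionBound m
  have h2 : Tendsto (fun n => 1 - proportionBound m n) atTop (nhds (1 / 2)) := by
    convert h1.const_sub 1 using 2
    norm_num
  refine (tendsto_of_tendsto_of_tendsto_of_le_of_le' h1 h2 ?_ ?_).limsup_eq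
  · exact proportionBound_le fun x y => by have := hC x y; tauto
  · have h3 : ∀ x y : ℤ, (x, y) ∈ Cᶜ ∨ (x + m, y) ∈ Cᶜ := fun x y => by
      have := hC x y
      simp only [Set.mem_compl_iff]
      tauto
    filter_upwards [proportionBound_le h3] with n hn
    linarith [proportion_add_proportion_compl C n]

lemma eq_of_mem_ball_diff {r : ℕ} {Δ : ℝ}
    (h : ((r : ℝ) + Δ) ^ 2 ≥ (r : ℝ) ^ 2 + 2 * (r : ℝ) - 1) {s : ℤ} (hs : s = 1 ∨ s = -1)
    {u p : ℤ × ℤ} (h1 : p ∈ ball r u) (h2 : p ∉ ball (r + Δ) (u.1 + s, u.2)) :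
    p = (u.1 - s * r, u.2) := by
  simp only [ball, Set.mem_ofPred_eq, not_le] at h1 h2
  have h1' : (p.1 - u.1) ^ 2 + (p.2 - u.2) ^ 2 ≤ (r : ℤ) ^ 2 := by exact_mod_cast h1
  have h2' : (r : ℤ) ^ 2 + 2 * r - 1 < (p.1 - (u.1 + s)) ^ 2 + (p.2 - u.2) ^ 2 := by
    have := h.trans_lt h2
    exact_mod_cast this
  set x := p.1 - u.1 with hx
  set y := p.2 - u.2 with hy
  have hs2 : s ^ 2 = 1 := by rcases hs with rfl | rfl <;> norm_num
  have h3 : (p.1 - (u.1 + s)) ^ 2 = x ^ 2 - 2 * (s * x) + 1 := by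
    rw [← hs2, hx]; ring
  have h4 : (r : ℤ) ≤ -(s * x) := by linarith
  have h5 : (s * x) ^ 2 = x ^ 2 := by rw [mul_pow, hs2, one_mul]
  have h6 : y = 0 := by
    have : y ^ 2 ≤ 0 := by nlinarith
    exact pow_eq_zero_iff (two_ne_zero) |>.1 (le_antisymm this (sq_nonneg y))
  have h7 : s * x = -r := by
    have : -(s * x) ≤ r := (abs_le_of_sq_le_sq' (by nlinarith) (by positivity)).2
    linarith
  refine Prod.ext ?_ ?_ <;> simp only
  · rcases hs with rfl | rfl <;> omega
  · omega

lemma IsIdCode.mem_or_mem {r : ℕ} {Δ : ℝ}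
    (h : ((r : ℝ) + Δ) ^ 2 ≥ (r : ℝ) ^ 2 + 2 * (r : ℝ) - 1) {C : Set (ℤ × ℤ)}
    (hC : IsIdCode r Δ C) (x y : ℤ) : (x, y) ∈ C ∨ (x + (2 * r + 1 : ℕ), y) ∈ C := by
  obtain ⟨p, hp, hpC⟩ := hC.2 (x + r, y) (x + r + 1, y) (by simp)
  rcases hp with ⟨h1, h2⟩ | ⟨h1, h2⟩
  · have := eq_of_mem_ball_diff h (Or.inl rfl) h1 h2
    left
    simpa [this] using hpC
  · have := eq_of_mem_ball_diff h (Or.inr rfl) h1 (by simpa using h2)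
    right
    rw [this] at hpC
    convert hpC using 2
    push_cast
    ring

theorem stmt11 (r : ℕ) (hr : 0 < r) (Δ : ℝ) (hΔ0 : 0 ≤ Δ) (hΔ1 : Δ < 1)
    (h : ((r : ℝ) + Δ) ^ 2 ≥ (r : ℝ) ^ 2 + 2 * (r : ℝ) - 1) :
    (∃ C : Set (ℤ × ℤ), IsIdCode (r : ℝ) Δ C ∧ density C = 1 / 2) ∧
      ∀ C' : Set (ℤ × ℤ), IsIdCode (r : ℝ) Δ C' → density C' ≥ 1 / 2 := by
  have hr' : (1 : ℤ) ≤ r := by omega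
  refine ⟨⟨stripeCode r, isIdCode_stripeCode hr hΔ0 hΔ1, density_eq_half (m := 2 * r + 1) ?_⟩,
    fun C' hC' => half_le_density (hC'.mem_or_mem h)⟩
  intro x y
  push_cast
  exact mem_stripeCode_add_fst hr' x y
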